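/- Let n ≥ 4 be an integer and write m = ⌊n/2⌋. Then Q_{n,2}(x) + Q_{n,4}(x) − Q_{n,3}(x) ≥ 0 for every x ∈ ℝ_+^m. -/

import Mathlib

/-- `N_{(a,b,c)}`: the number of distinct ordered triples obtained by permuting `(a,b,c)`. -/
def Ntriple (p : ℕ × ℕ × ℕ) : ℕ :=
  ({(p.1, p.2.1, p.2.2), (p.1, p.2.2, p.2.1), (p.2.1, p.1, p.2.2),
    (p.2.1, p.2.2, p.1), (p.2.2, p.1, p.2.1), (p.2.2, p.2.1, p.1)} : Finset (ℕ × ℕ × ℕ)).card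

/-- The weight `θ_{n,(a,b,c)} = N_{(a,b,c)}/3`. -/
noncomputable def thetaTri (p : ℕ × ℕ × ℕ) : ℝ := (Ntriple p : ℝ) / 3

/-- `w_{n,(a,b,c)} = sin²(πa/n) + sin²(πb/n) + sin²(πc/n)`. -/
noncomputable def wTri (n : ℕ) (p : ℕ × ℕ × ℕ) : ℝ :=
  Real.sin (Real.pi * p.1 / n) ^ 2 + Real.sin (Real.pi * p.2.1 / n) ^ 2 +
    Real.sin (Real.pi * p.2.2 / n) ^ 2

/-- `A_{n,(a,b,c)}^{(c)} = w²/(4(sin²(πa/n)+sin²(πb/n)))`. -/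
noncomputable def AcTri (n : ℕ) (p : ℕ × ℕ × ℕ) : ℝ :=
  wTri n p ^ 2 / (4 * (Real.sin (Real.pi * p.1 / n) ^ 2 + Real.sin (Real.pi * p.2.1 / n) ^ 2))

/-- `A_{n,(a,b,c)}^{(b)} = w²/(4(sin²(πa/n)+sin²(πc/n)))`. -/
noncomputable def AbTri (n : ℕ) (p : ℕ × ℕ × ℕ) : ℝ :=
  wTri n p ^ 2 / (4 * (Real.sin (Real.pi * p.1 / n) ^ 2 + Real.sin (Real.pi * p.2.2 / n) ^ 2))

/-- The index set `E_n`: triples `1 ≤ a ≤ b ≤ c ≤ ⌊n/2⌋` with `a+b = c` or `a+b+c = n`.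
For odd `n = 2m+1` this is `E_n^{(1)} ∪ E_n^{(2)}`, and for even `n = 2m` it is
`E_n^{(1)} ∪ E_n^{(2)} ∪ E_n^{(3)}` (triples of `E_n^{(2)}` with `c = m` satisfy `a+b = m = c`
and hence coincide with `E_n^{(3)}`). -/
def Etri (n : ℕ) : Finset (ℕ × ℕ × ℕ) :=
  (Finset.range (n / 2 + 1) ×ˢ Finset.range (n / 2 + 1) ×ˢ Finset.range (n / 2 + 1)).filter
    fun p => 1 ≤ p.1 ∧ p.1 ≤ p.2.1 ∧ p.2.1 ≤ p.2.2 ∧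
      (p.1 + p.2.1 = p.2.2 ∨ p.1 + p.2.1 + p.2.2 = n)

/-- `Q_{n,3}(x) = (1/n³)·∑_{(a,b,c)∈E_n} θ_{n,(a,b,c)}·w_{n,(a,b,c)}·x_a·x_b·x_c`. -/
noncomputable def Q3 (n : ℕ) (x : ℕ → ℝ) : ℝ :=
  (1 / (n : ℝ) ^ 3) * ∑ p ∈ Etri n, thetaTri p * wTri n p * x p.1 * x p.2.1 * x p.2.2

/-- `Q_{n,2}`: for odd `n = 2m+1`, `(2/n²)·∑_{k=1}^{m}(k−1)·sin²(πk/n)·x_k²`; for even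
`n = 2m`, `(2/n²)·∑_{k=1}^{m−1}(k−1)·sin²(πk/n)·x_k² + ((m−1)/n²)·x_m²`. -/
noncomputable def Q2 (n : ℕ) (x : ℕ → ℝ) : ℝ :=
  if n % 2 = 1 then
    (2 / (n : ℝ) ^ 2) * ∑ k ∈ Finset.Icc 1 (n / 2),
      ((k : ℝ) - 1) * Real.sin (Real.pi * k / n) ^ 2 * x k ^ 2
  else
    (2 / (n : ℝ) ^ 2) * ∑ k ∈ Finset.Icc 1 (n / 2 - 1),
      ((k : ℝ) - 1) * Real.sin (Real.pi * k / n) ^ 2 * x k ^ 2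
    + (((n / 2 : ℕ) : ℝ) - 1) / (n : ℝ) ^ 2 * x (n / 2) ^ 2

/-- `Q_{n,4}`: for odd `n = 2m+1`, `(2/n⁴)(∑_{k=1}^m x_k²)(∑_{k=1}^m sin²(πk/n)x_k²)`; for
even `n = 2m`, `(2/n⁴)(∑_{k=1}^{m−1} x_k² + x_m²/2)(∑_{k=1}^{m−1} sin²(πk/n)x_k² + x_m²/2)`. -/
noncomputable def Q4 (n : ℕ) (x : ℕ → ℝ) : ℝ :=
  if n % 2 = 1 then
    (2 / (n : ℝ) ^ 4) * (∑ k ∈ Finset.Icc 1 (n / 2), x k ^ 2) *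
      (∑ k ∈ Finset.Icc 1 (n / 2), Real.sin (Real.pi * k / n) ^ 2 * x k ^ 2)
  else
    (2 / (n : ℝ) ^ 4) * ((∑ k ∈ Finset.Icc 1 (n / 2 - 1), x k ^ 2) + x (n / 2) ^ 2 / 2) *
      ((∑ k ∈ Finset.Icc 1 (n / 2 - 1), Real.sin (Real.pi * k / n) ^ 2 * x k ^ 2)
        + x (n / 2) ^ 2 / 2)


namespace QProof

/-- multiplicity of the cost of a triple -/
noncomputable def mu (p : ℕ × ℕ × ℕ) : ℝ :=
  if p.2.1 = p.2.2 then 1 / 2 else if p.1 = p.2.1 then 1 else 2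

/-- multiplicity of a pair -/
noncomputable def nu (a b : ℕ) : ℝ := if a = b then 1 else 2

lemma mu_nonneg (p : ℕ × ℕ × ℕ) : 0 ≤ mu p := by
  unfold mu; split_ifs <;> norm_num

lemma amgm (w p B X Y : ℝ) (hp : 0 ≤ p) (hB : 0 ≤ B) (h : w ^ 2 ≤ 4 * p * B) :
    w * X * Y ≤ p * X ^ 2 + B * Y ^ 2 := by
  apply le_of_sq_le_sq _ (by positivity)
  have : (w * X * Y) ^ 2 ≤ 4 * p * B * (X ^ 2 * Y ^ 2) := by
    have := mul_le_mul_of_nonneg_right h (by positivity : 0 ≤ X ^ 2 * Y ^ 2)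
    nlinarith
  nlinarith [sq_nonneg (p * X ^ 2 - B * Y ^ 2)]
where le_of_sq_le_sq {a b : ℝ} (h : a ^ 2 ≤ b ^ 2) (hb : 0 ≤ b) : a ≤ b :=
  le_of_abs_le (abs_le_of_sq_le_sq h hb)

lemma theta_lt (a b c : ℕ) (h1 : a < b) (h2 : b < c) : thetaTri (a, b, c) = 2 := by
  have e1 : a ≠ b := by omega
  have e2 : b ≠ c := by omega
  have e3 : a ≠ c := by omega
  simp [thetaTri, Ntriple, Finset.card_insert_of_notMem, e1, e2, e3, e1.symm, e2.symm, e3.symm]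
  norm_num

lemma theta_eq1 (a c : ℕ) (h2 : a < c) : thetaTri (a, a, c) = 1 := by
  have e3 : a ≠ c := by omega
  have : Ntriple (a, a, c) = 3 := by
    have : ({(a, a, c), (a, c, a), (a, a, c), (a, c, a), (c, a, a), (c, a, a)} :
      Finset (ℕ × ℕ × ℕ)) = {(a, a, c), (a, c, a), (c, a, a)} := by
      ext p; simp only [Finset.mem_insert, Finset.mem_singleton]; tauto
    unfold Ntriple
    simp only [this]
    simp [Finset.card_insert_of_notMem, e3, e3.symm]
  simp [thetaTri, this]

lemma theta_eq2 (a c : ℕ) (h2 : a < c) : thetaTri (a, c, c) = 1 := by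
  have e3 : a ≠ c := by omega
  have : Ntriple (a, c, c) = 3 := by
    have : ({(a, c, c), (a, c, c), (c, a, c), (c, c, a), (c, a, c), (c, c, a)} :
      Finset (ℕ × ℕ × ℕ)) = {(a, c, c), (c, a, c), (c, c, a)} := by
      ext p; simp only [Finset.mem_insert, Finset.mem_singleton]; tauto
    unfold Ntriple
    simp only [this]
    simp [Finset.card_insert_of_notMem, e3, e3.symm]
  simp [thetaTri, this]

lemma theta_eq3 (a : ℕ) : thetaTri (a, a, a) = 1 / 3 := by
  simp [thetaTri, Ntriple]

lemma term_le (a b c : ℕ) (w p B X Y : ℝ) (hab : a ≤ b) (hbc : b ≤ c)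
    (hp : 0 ≤ p) (hB : 0 ≤ B) (h : w ^ 2 ≤ 4 * p * B) :
    thetaTri (a, b, c) * (w * X * Y) ≤ nu a b * (p * X ^ 2) + mu (a, b, c) * (B * Y ^ 2) := by
  have k1 := amgm w p B X Y hp hB h
  have k2 := amgm w (2 * p) (B / 2) X Y (by positivity) (by positivity) (by linarith)
  have hX : 0 ≤ p * X ^ 2 := by positivity
  have hY : 0 ≤ B * Y ^ 2 := by positivity
  rcases hab.lt_or_eq with h1 | h1 <;> rcases hbc.lt_or_eq with h2 | h2
  · rw [theta_lt a b c h1 h2]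
    simp only [nu, mu, h1.ne, h2.ne, if_false]
    linarith
  · subst h2
    rw [theta_eq2 a b h1]
    simp only [nu, mu, h1.ne, if_false, if_true]
    linarith
  · subst h1
    rw [theta_eq1 a c h2]
    simp only [nu, mu, h2.ne, if_false, if_true]
    linarith
  · subst h1; subst h2
    rw [theta_eq3]
    simp only [nu, mu, if_true]
    linarith

lemma alg1 (C t : ℝ) (hC : 0 ≤ C) (h1 : C ≤ t) (h2 : t ≤ 1) :
    (1 - C * t + (1 - C ^ 2)) ^ 2 ≤ 4 * (1 - C * t) * ((1 + C ^ 2 / 2) * (1 - C ^ 2)) := by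
  have key : (t - C) ^ 2 ≤ 2 * (1 - C ^ 2) * (1 - C * t) := by
    have a1 : (t - C) ^ 2 ≤ (1 - C) ^ 2 := by nlinarith
    have a2 : (1 - C) ≤ (1 - C * t) := by nlinarith
    have a3 : (1 - C) ^ 2 ≤ (1 - C ^ 2) * (1 - C) := by nlinarith [mul_nonneg hC (sq_nonneg (1 - C))]
    have a4 : (1 - C ^ 2) * (1 - C) ≤ (1 - C ^ 2) * (1 - C * t) :=
      mul_le_mul_of_nonneg_left a2 (by nlinarith)
    nlinarith [sq_nonneg (t - C)]
  nlinarith [mul_le_mul_of_nonneg_left key (sq_nonneg C)]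

lemma alg2 (C t : ℝ) (hC : 0 ≤ C) (hC2 : C ≤ 1 / 2) (h1 : 0 ≤ t) (h2 : t ≤ 1) :
    (1 + C * t + (1 - C ^ 2)) ^ 2 ≤ 4 * (1 + C * t) * ((1 + C ^ 2 / 2) * (1 - C ^ 2)) := by
  have key : (t + C) ^ 2 ≤ 2 * (1 - C ^ 2) * (1 + C * t) := by
    have a1 : (1 + C) ^ 2 ≤ 2 * (1 - C ^ 2) * (1 + C) := by
      nlinarith [mul_nonneg (sq_nonneg (1 + C)) (by linarith : (0:ℝ) ≤ 1 / 2 - C)]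
    have a0 : C ^ 2 ≤ 2 * (1 - C ^ 2) := by nlinarith
    nlinarith [mul_le_mul_of_nonneg_left a1 h1,
      mul_le_mul_of_nonneg_left a0 (by linarith : (0:ℝ) ≤ 1 - t), mul_nonneg h1 (by linarith : (0:ℝ) ≤ 1 - t)]
  nlinarith [mul_le_mul_of_nonneg_left key (sq_nonneg C)]

lemma sin_sq_add (α β : ℝ) :
    Real.sin α ^ 2 + Real.sin β ^ 2 = 1 - Real.cos (α + β) * Real.cos (α - β) := by
  rw [Real.cos_add, Real.cos_sub]
  nlinarith [Real.sin_sq_add_cos_sq α, Real.sin_sq_add_cos_sq β]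

lemma mem_E {n a b c : ℕ} : (a, b, c) ∈ Etri n ↔
    1 ≤ a ∧ a ≤ b ∧ b ≤ c ∧ c ≤ n / 2 ∧ (a + b = c ∨ a + b + c = n) := by
  simp only [Etri, Finset.mem_filter, Finset.mem_product, Finset.mem_range]
  omega

/-- cost per unit -/
noncomputable def Bc (n c : ℕ) : ℝ :=
  (1 + Real.cos (Real.pi * c / n) ^ 2 / 2) * Real.sin (Real.pi * c / n) ^ 2

lemma Bc_nonneg (n c : ℕ) : 0 ≤ Bc n c := by unfold Bc; positivity

lemma w_sq_le (n a b c : ℕ) (hn : 4 ≤ n) (h : (a, b, c) ∈ Etri n) :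
    wTri n (a, b, c) ^ 2 ≤
      4 * (Real.sin (Real.pi * a / n) ^ 2 + Real.sin (Real.pi * b / n) ^ 2) * Bc n c := by
  obtain ⟨h1, h2, h3, h4, h5⟩ := mem_E.1 h
  have hn0 : (0:ℝ) < n := by positivity
  have hpi := Real.pi_pos
  have hab : Real.pi * a / n ≤ Real.pi * b / n := by gcongr
  have hbc : Real.pi * b / n ≤ Real.pi * c / n := by gcongr
  have ha0 : 0 ≤ Real.pi * a / n := by positivity
  have hc2 : Real.pi * c / n ≤ Real.pi / 2 := by
    rw [div_le_div_iff₀ hn0 (by norm_num)]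
    have : (c:ℝ) * 2 ≤ n := by exact_mod_cast (by omega : c * 2 ≤ n)
    nlinarith
  have hC0 : 0 ≤ Real.cos (Real.pi * c / n) :=
    Real.cos_nonneg_of_neg_pi_div_two_le_of_le (by linarith) hc2
  unfold wTri Bc
  simp only
  rw [sin_sq_add, Real.sin_sq (Real.pi * c / n)]
  rcases h5 with h5 | h5
  · have e : Real.pi * a / n + Real.pi * b / n = Real.pi * c / n := by
      rw [← h5]; push_cast; ring
    rw [e]
    apply alg1 _ _ hC0 _ (Real.cos_le_one _)
    rw [← Real.cos_abs (Real.pi * a / n - Real.pi * b / n)]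
    apply Real.cos_le_cos_of_nonneg_of_le_pi (abs_nonneg _) (by linarith)
    rw [abs_le]; constructor <;> linarith
  · have e : Real.pi * a / n + Real.pi * b / n = Real.pi - Real.pi * c / n := by
      rw [eq_sub_iff_add_eq, ← add_div, ← add_div, div_eq_iff hn0.ne', ← h5]; push_cast; ring
    rw [e, Real.cos_pi_sub]
    have hC2 : Real.cos (Real.pi * c / n) ≤ 1 / 2 := by
      rw [← Real.cos_pi_div_three]
      apply Real.cos_le_cos_of_nonneg_of_le_pi (by positivity) (by linarith)
      linarith
    have := alg2 _ (Real.cos (Real.pi * a / n - Real.pi * b / n)) hC0 hC2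
      (Real.cos_nonneg_of_neg_pi_div_two_le_of_le (by linarith) (by linarith)) (Real.cos_le_one _)
    simpa only [neg_mul, sub_neg_eq_add] using this

lemma G_le (e : ℕ) (he : 1 ≤ e) :
    ∑ j ∈ Finset.Icc 1 (e / 2), (if 2 * j = e then (1:ℝ) else 2) = e - 1 := by
  rcases Nat.even_or_odd' e with ⟨k, rfl | rfl⟩
  · obtain ⟨k, rfl⟩ : ∃ l, k = l + 1 := ⟨k - 1, by omega⟩
    rw [show 2 * (k + 1) / 2 = k + 1 by omega, Finset.sum_Icc_succ_top (by omega)]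
    rw [Finset.sum_congr rfl (g := fun _ => (2:ℝ))]
    · simp; ring
    · intro j hj
      rw [Finset.mem_Icc] at hj
      rw [if_neg (by omega)]
  · rw [show (2 * k + 1) / 2 = k by omega, Finset.sum_congr rfl (g := fun _ => (2:ℝ))]
    · simp; ring
    · intro j hj
      rw [if_neg (by omega)]

/-- fiber of the triples with largest entry `c` -/
def fib (n c : ℕ) : Finset (ℕ × ℕ × ℕ) := (Etri n).filter fun p => p.2.2 = c

def T1 (c : ℕ) : Finset (ℕ × ℕ × ℕ) := (Finset.Icc 1 (c / 2)).image fun a => (a, c - a, c)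
def T2 (n c : ℕ) : Finset (ℕ × ℕ × ℕ) :=
  (Finset.Icc 1 ((3 * c - n) / 2)).image fun j => (n - 2 * c + j, c - j, c)

lemma T1_sum (c : ℕ) (hc : 1 ≤ c) : ∑ p ∈ T1 c, mu p = c - 1 := by
  rw [T1, Finset.sum_image, ← G_le c hc]
  · apply Finset.sum_congr rfl
    intro a ha
    rw [Finset.mem_Icc] at ha
    simp only [mu]
    rw [if_neg (by omega)]
    congr 1
    apply propext; omega
  · intro a _ b _ h
    exact (Prod.mk.inj h).1

lemma T2_sum (n c : ℕ) (hc : n < 3 * c) (hc2 : 2 * c < n) :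
    ∑ p ∈ T2 n c, mu p = 3 * c - n - 1 := by
  rw [T2, Finset.sum_image]
  · have := G_le (3 * c - n) (by omega)
    rw [Nat.cast_sub hc.le] at this
    push_cast at this
    rw [← this]
    apply Finset.sum_congr rfl
    intro a ha
    rw [Finset.mem_Icc] at ha
    simp only [mu]
    rw [if_neg (by omega)]
    congr 1
    apply propext; omega
  · intro a _ b _ h
    have := (Prod.mk.inj h).1
    omega

lemma sum_union_le' (A B : Finset (ℕ × ℕ × ℕ)) :
    ∑ p ∈ A ∪ B, mu p ≤ ∑ p ∈ A, mu p + ∑ p ∈ B, mu p := by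
  rw [← Finset.sum_union_inter]
  have : 0 ≤ ∑ p ∈ A ∩ B, mu p := Finset.sum_nonneg fun p _ => mu_nonneg p
  linarith

lemma fib_le {n c : ℕ} {S : Finset (ℕ × ℕ × ℕ)} (h : ∀ a b, (a, b, c) ∈ Etri n → (a, b, c) ∈ S) :
    ∑ p ∈ fib n c, mu p ≤ ∑ p ∈ S, mu p := by
  apply Finset.sum_le_sum_of_subset_of_nonneg
  · rintro ⟨a, b, c'⟩ hp
    rw [fib, Finset.mem_filter] at hp
    obtain ⟨hp, rfl⟩ := hp
    exact h a b hp
  · intro p _ _; exact mu_nonneg p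

lemma fib1 (n c : ℕ) (hc : 1 ≤ c) (h : 3 * c < n ∨ 2 * c = n) :
    ∑ p ∈ fib n c, mu p ≤ c - 1 := by
  rw [← T1_sum c hc]
  apply fib_le
  intro a b hp
  have := mem_E.1 hp
  simp only [T1, Finset.mem_image, Finset.mem_Icc, Prod.mk.injEq, and_true]
  exact ⟨a, by omega, rfl, by omega⟩

lemma fib2 (n c : ℕ) (hc : 1 ≤ c) (h : 3 * c = n) :
    ∑ p ∈ fib n c, mu p ≤ c - 1 / 2 := by
  have : ∑ p ∈ fib n c, mu p ≤ ∑ p ∈ T1 c ∪ {(c, c, c)}, mu p := by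
    apply fib_le
    intro a b hp
    have := mem_E.1 hp
    simp only [T1, Finset.mem_union, Finset.mem_singleton, Finset.mem_image, Finset.mem_Icc,
      Prod.mk.injEq, and_true]
    by_cases h : a + b = c
    · left; exact ⟨a, by omega, rfl, by omega⟩
    · right; omega
  have h2 := sum_union_le' (T1 c) {(c, c, c)}
  rw [T1_sum c hc, Finset.sum_singleton] at h2
  rw [show mu (c, c, c) = 1 / 2 by simp [mu]] at h2
  linarith

lemma fib3 (n c : ℕ) (hc : 1 ≤ c) (h : n < 3 * c) (h2c : 2 * c < n) :
    ∑ p ∈ fib n c, mu p ≤ 4 * c - n - 3 / 2 := by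
  have : ∑ p ∈ fib n c, mu p ≤ ∑ p ∈ (T1 c ∪ T2 n c) ∪ {(n - 2 * c, c, c)}, mu p := by
    apply fib_le
    intro a b hp
    have := mem_E.1 hp
    simp only [T1, T2, Finset.mem_union, Finset.mem_singleton, Finset.mem_image, Finset.mem_Icc,
      Prod.mk.injEq, and_true]
    by_cases h : a + b = c
    · left; left; exact ⟨a, by omega, rfl, by omega⟩
    · by_cases h' : b = c
      · right; omega
      · left; right; exact ⟨c - b, by omega, by omega, by omega⟩
  have h2 := sum_union_le' (T1 c ∪ T2 n c) {(n - 2 * c, c, c)}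
  have h3 := sum_union_le' (T1 c) (T2 n c)
  rw [Finset.sum_singleton] at h2
  rw [T1_sum c hc, T2_sum n c h h2c] at h3
  rw [show mu (n - 2 * c, c, c) = 1 / 2 by simp [mu]] at h2
  linarith

lemma cost_lt (n c : ℕ) (hn : 4 ≤ n) (hc : 1 ≤ c) (h2c : 2 * c < n) :
    (∑ p ∈ fib n c, mu p) * Bc n c ≤ 2 * ((c:ℝ) - 1) * Real.sin (Real.pi * c / n) ^ 2 := by
  have hn0 : (4:ℝ) ≤ n := by exact_mod_cast hn
  have hc1 : (1:ℝ) ≤ c := by exact_mod_cast hc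
  unfold Bc
  rw [← mul_assoc]
  apply mul_le_mul_of_nonneg_right _ (sq_nonneg _)
  set C := Real.cos (Real.pi * c / n) with hC
  have hC1 : C ^ 2 ≤ 1 := Real.cos_sq_le_one _
  have hC0 : 0 ≤ C ^ 2 := sq_nonneg _
  rcases lt_trichotomy (3 * c) n with h | h | h
  · have := fib1 n c hc (Or.inl h)
    calc _ ≤ ((c:ℝ) - 1) * (1 + C ^ 2 / 2) := by gcongr
      _ ≤ _ := by nlinarith
  · have := fib2 n c hc h
    have hc2 : (2:ℝ) ≤ c := by exact_mod_cast (by omega : 2 ≤ c)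
    have hCv : C = 1 / 2 := by
      rw [hC, ← Real.cos_pi_div_three, ← h]; congr 1; push_cast; field_simp
    rw [hCv]
    nlinarith
  · have := fib3 n c hc h h2c
    have h3 : (n:ℝ) + 1 ≤ 3 * c := by exact_mod_cast h
    have h2 : 2 * (c:ℝ) + 1 ≤ n := by exact_mod_cast h2c
    obtain ⟨d, hd⟩ : ∃ d : ℝ, d = n - 2 * c := ⟨_, rfl⟩
    have hCd : C ≤ Real.pi * d / (2 * n) := by
      rw [hC, ← Real.sin_pi_div_two_sub]
      have : Real.pi / 2 - Real.pi * c / n = Real.pi * d / (2 * n) := by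
        rw [hd]; field_simp
      rw [this]
      apply Real.sin_le
      have : 0 ≤ d := by linarith
      have := Real.pi_pos
      positivity
    have hCp : 0 ≤ C := by
      apply Real.cos_nonneg_of_neg_pi_div_two_le_of_le
      · have := Real.pi_pos
        have : 0 ≤ Real.pi * c / n := by positivity
        linarith
      · rw [div_le_div_iff₀ (by linarith) (by norm_num)]
        nlinarith [Real.pi_pos]
    have hCn : 2 * n * C ≤ 3.15 * d := by
      rw [le_div_iff₀ (by linarith)] at hCd
      nlinarith [Real.pi_lt_d2]
    have hsq : (2 * n * C) ^ 2 ≤ (3.15 * d) ^ 2 := by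
      apply pow_le_pow_left₀ (by positivity) hCn
    have hkey : n * C ^ 2 / 2 ≤ d - 1 / 2 := by
      have hd3 : 3 * d ≤ n := by linarith
      have h8 : (n:ℝ) * (n * C ^ 2 / 2) ≤ n * (d - 1 / 2) := by
        have : d * (3 * d) ≤ d * n := mul_le_mul_of_nonneg_left hd3 (by linarith)
        nlinarith
      exact le_of_mul_le_mul_left h8 (by linarith)
    calc _ ≤ (4 * (c:ℝ) - n - 3 / 2) * (1 + C ^ 2 / 2) := by gcongr
      _ ≤ _ := by nlinarith

lemma sum_nu (S : Finset ℕ) (f : ℕ → ℕ → ℝ) (hf : ∀ a b, f a b = f b a) :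
    ∑ q ∈ (S ×ˢ S).filter (fun q => q.1 ≤ q.2), nu q.1 q.2 * f q.1 q.2 =
      ∑ q ∈ S ×ˢ S, f q.1 q.2 := by
  have h0 : ∑ q ∈ S ×ˢ S, (if q.2 < q.1 then f q.1 q.2 else 0) =
      ∑ q ∈ S ×ˢ S, (if q.1 < q.2 then f q.1 q.2 else 0) := by
    apply Finset.sum_nbij' Prod.swap Prod.swap
    · intro q; simp; tauto
    · intro q; simp; tauto
    · intro q _; simp
    · intro q _; simp
    · intro q _; simp [hf q.1 q.2]
  rw [Finset.sum_filter]
  have h1 : ∑ q ∈ S ×ˢ S, f q.1 q.2 = ∑ q ∈ S ×ˢ S, (if q.1 ≤ q.2 then f q.1 q.2 else 0)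
      + ∑ q ∈ S ×ˢ S, (if q.2 < q.1 then f q.1 q.2 else 0) := by
    rw [← Finset.sum_add_distrib]
    apply Finset.sum_congr rfl
    intro q _
    by_cases h : q.1 ≤ q.2
    · simp [h, not_lt.2 h]
    · simp [h, not_le.1 h]
  rw [h1, h0, ← Finset.sum_add_distrib]
  apply Finset.sum_congr rfl
  intro q _
  rcases lt_trichotomy q.1 q.2 with h | h | h
  · simp [nu, h, h.le, h.ne]; ring
  · simp [nu, h]
  · simp [not_le.2 h, not_lt.2 h.le]

lemma pair_part (n : ℕ) (s y : ℕ → ℝ) (hs : ∀ k, 0 ≤ s k) :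
    ∑ p ∈ Etri n, nu p.1 p.2.1 * ((s p.1 + s p.2.1) * (y p.1 * y p.2.1) ^ 2) ≤
      2 * (∑ k ∈ Finset.Icc 1 ((n - 1) / 2), y k ^ 2) *
        (∑ k ∈ Finset.Icc 1 ((n - 1) / 2), s k * y k ^ 2) := by
  set S := Finset.Icc 1 ((n - 1) / 2) with hS
  have e : 2 * (∑ k ∈ S, y k ^ 2) * (∑ k ∈ S, s k * y k ^ 2) =
      ∑ q ∈ S ×ˢ S, (s q.1 + s q.2) * (y q.1 * y q.2) ^ 2 := by
    have e1 : (∑ k ∈ S, y k ^ 2) * (∑ k ∈ S, s k * y k ^ 2) =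
        ∑ q ∈ S ×ˢ S, y q.1 ^ 2 * (s q.2 * y q.2 ^ 2) := by
      rw [Finset.sum_mul_sum, Finset.sum_product]
    have e2 : (∑ k ∈ S, s k * y k ^ 2) * (∑ k ∈ S, y k ^ 2) =
        ∑ q ∈ S ×ˢ S, (s q.1 * y q.1 ^ 2) * y q.2 ^ 2 := by
      rw [Finset.sum_mul_sum, Finset.sum_product]
    rw [mul_assoc, two_mul]
    nth_rewrite 2 [mul_comm]
    rw [e1, e2, ← Finset.sum_add_distrib]
    apply Finset.sum_congr rfl
    intro q _; ring
  rw [e, ← sum_nu S (fun a b => (s a + s b) * (y a * y b) ^ 2) (by intro a b; ring)]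
  have inj : Set.InjOn (fun p : ℕ × ℕ × ℕ => (p.1, p.2.1)) (Etri n : Set (ℕ × ℕ × ℕ)) := by
    rintro ⟨a, b, c⟩ hp ⟨a', b', c'⟩ hp' h
    have h1 := mem_E.1 (Finset.mem_coe.1 hp)
    have h2 := mem_E.1 (Finset.mem_coe.1 hp')
    simp only [Prod.mk.injEq] at h ⊢
    omega
  rw [← Finset.sum_image (s := Etri n) (g := fun p : ℕ × ℕ × ℕ => (p.1, p.2.1))
    (f := fun q : ℕ × ℕ => nu q.1 q.2 * ((s q.1 + s q.2) * (y q.1 * y q.2) ^ 2)) inj]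
  apply Finset.sum_le_sum_of_subset_of_nonneg
  · intro q hq
    obtain ⟨⟨a, b, c⟩, hp, rfl⟩ := Finset.mem_image.1 hq
    have := mem_E.1 hp
    simp only [hS, Finset.mem_filter, Finset.mem_product, Finset.mem_Icc]
    omega
  · intro q _ _
    have h1 := hs q.1
    have h2 := hs q.2
    have : 0 ≤ nu q.1 q.2 := by unfold nu; split_ifs <;> norm_num
    positivity

lemma main_le (n : ℕ) (hn : 4 ≤ n) (y : ℕ → ℝ) :
    ∑ p ∈ Etri n, thetaTri p * wTri n p * y p.1 * y p.2.1 * y p.2.2 ≤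
      2 * (∑ k ∈ Finset.Icc 1 ((n - 1) / 2), y k ^ 2) *
        (∑ k ∈ Finset.Icc 1 ((n - 1) / 2), Real.sin (Real.pi * k / n) ^ 2 * y k ^ 2) +
      ∑ c ∈ Finset.Icc 1 (n / 2), (∑ p ∈ fib n c, mu p) * Bc n c * y c ^ 2 := by
  have h1 := pair_part n (fun k => Real.sin (Real.pi * k / n) ^ 2) y (fun k => sq_nonneg _)
  have h2 : ∑ c ∈ Finset.Icc 1 (n / 2), (∑ p ∈ fib n c, mu p) * Bc n c * y c ^ 2 =
      ∑ p ∈ Etri n, mu p * (Bc n p.2.2 * y p.2.2 ^ 2) := by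
    rw [← Finset.sum_fiberwise_of_maps_to (s := Etri n) (t := Finset.Icc 1 (n / 2))
      (g := fun p => p.2.2)]
    · apply Finset.sum_congr rfl
      intro c _
      rw [mul_assoc, Finset.sum_mul]
      apply Finset.sum_congr rfl
      intro p hp
      rw [fib, Finset.mem_filter] at hp
      rw [hp.2]
    · rintro ⟨a, b, c⟩ hp
      have := mem_E.1 hp
      simp only [Finset.mem_Icc]; omega
  rw [h2]
  refine le_trans ?_ (add_le_add_left h1 _)
  rw [← Finset.sum_add_distrib]
  apply Finset.sum_le_sum
  rintro ⟨a, b, c⟩ hp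
  have h := mem_E.1 hp
  have := term_le a b c (wTri n (a, b, c)) _ (Bc n c) (y a * y b) (y c) h.2.1 h.2.2.1
    (by positivity) (Bc_nonneg n c) (w_sq_le n a b c hn hp)
  refine le_trans (le_of_eq ?_) this
  ring

end QProof

open QProof in
/-- For every `n ≥ 4`, `Q_{n,2}(x) + Q_{n,4}(x) − Q_{n,3}(x) ≥ 0` for every
`x ∈ ℝ_+^{⌊n/2⌋}` (only the coordinates `x_1,…,x_{⌊n/2⌋}` occur). -/
theorem Q2_add_Q4_sub_Q3_nonneg (n : ℕ) (hn : 4 ≤ n) (x : ℕ → ℝ) (hx : ∀ i, 0 ≤ x i) :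
    0 ≤ Q2 n x + Q4 n x - Q3 n x := by
  have hn0 : (n:ℝ) ≠ 0 := by positivity
  obtain ⟨y, rfl⟩ : ∃ y : ℕ → ℝ, x = fun k => n * y k :=
    ⟨fun k => x k / n, by funext k; field_simp⟩
  have hm := main_le n hn y
  have e3 : Q3 n (fun k => n * y k) =
      ∑ p ∈ Etri n, thetaTri p * wTri n p * y p.1 * y p.2.1 * y p.2.2 := by
    rw [Q3, Finset.mul_sum]
    apply Finset.sum_congr rfl
    intro p _
    field_simp
  have sq1 : ∀ S : Finset ℕ, ∑ k ∈ S, ((n:ℝ) * y k) ^ 2 = n ^ 2 * ∑ k ∈ S, y k ^ 2 := by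
    intro S; rw [Finset.mul_sum]; apply Finset.sum_congr rfl; intro k _; ring
  have sq2 : ∀ (S : Finset ℕ) (f : ℕ → ℝ),
      ∑ k ∈ S, f k * ((n:ℝ) * y k) ^ 2 = n ^ 2 * ∑ k ∈ S, f k * y k ^ 2 := by
    intro S f; rw [Finset.mul_sum]; apply Finset.sum_congr rfl; intro k _; ring
  have hcost : ∑ c ∈ Finset.Icc 1 ((n - 1) / 2), (∑ p ∈ fib n c, mu p) * Bc n c * y c ^ 2 ≤
      2 * ∑ k ∈ Finset.Icc 1 ((n - 1) / 2),
        ((k : ℝ) - 1) * Real.sin (Real.pi * k / n) ^ 2 * y k ^ 2 := by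
    rw [Finset.mul_sum]
    apply Finset.sum_le_sum
    intro c hc
    rw [Finset.mem_Icc] at hc
    have := mul_le_mul_of_nonneg_right (cost_lt n c hn hc.1 (by omega)) (sq_nonneg (y c))
    linarith
  rw [e3]
  by_cases hodd : n % 2 = 1
  · rw [Q2, Q4, if_pos hodd, if_pos hodd]
    rw [show (n - 1) / 2 = n / 2 by omega] at *
    simp only [sq1, sq2]
    set A := ∑ k ∈ Finset.Icc 1 (n / 2), y k ^ 2
    set B := ∑ k ∈ Finset.Icc 1 (n / 2), Real.sin (Real.pi * k / n) ^ 2 * y k ^ 2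
    set D := ∑ k ∈ Finset.Icc 1 (n / 2), ((k : ℝ) - 1) * Real.sin (Real.pi * k / n) ^ 2 * y k ^ 2
    have r1 : 2 / (n:ℝ) ^ 2 * (n ^ 2 * D) = 2 * D := by field_simp
    have r2 : 2 / (n:ℝ) ^ 4 * (n ^ 2 * A) * (n ^ 2 * B) = 2 * A * B := by field_simp
    rw [r1, r2]
    linarith
  · rw [Q2, Q4, if_neg hodd, if_neg hodd]
    obtain ⟨l, hl⟩ : ∃ l, n / 2 = l + 1 := ⟨n / 2 - 1, by omega⟩
    rw [show (n - 1) / 2 = l by omega] at *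
    rw [show n / 2 - 1 = l by omega]
    rw [hl] at hm ⊢
    rw [Finset.sum_Icc_succ_top (by omega)] at hm
    simp only [sq1, sq2]
    have hlast : (∑ p ∈ fib n (l + 1), mu p) * Bc n (l + 1) * y (l + 1) ^ 2 ≤
        (((l + 1 : ℕ) : ℝ) - 1) * y (l + 1) ^ 2 := by
      have hB : Bc n (l + 1) = 1 := by
        have : Real.pi * ((l + 1 : ℕ) : ℝ) / n = Real.pi / 2 := by
          rw [show n = 2 * (l + 1) by omega]; push_cast; field_simp
        rw [Bc, this]; simp
      rw [hB, mul_one]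
      exact mul_le_mul_of_nonneg_right (fib1 n (l + 1) (by omega) (by omega)) (sq_nonneg _)
    set A := ∑ k ∈ Finset.Icc 1 l, y k ^ 2 with hA
    set B := ∑ k ∈ Finset.Icc 1 l, Real.sin (Real.pi * k / n) ^ 2 * y k ^ 2 with hB
    set D := ∑ k ∈ Finset.Icc 1 l, ((k : ℝ) - 1) * Real.sin (Real.pi * k / n) ^ 2 * y k ^ 2
    set z := y (l + 1)
    set g := ((l + 1 : ℕ) : ℝ) - 1
    have hA0 : 0 ≤ A := Finset.sum_nonneg fun k _ => by positivity
    have hB0 : 0 ≤ B := Finset.sum_nonneg fun k _ => by positivity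
    have r1 : 2 / (n:ℝ) ^ 2 * (n ^ 2 * D) + g / (n:ℝ) ^ 2 * (n * z) ^ 2 = 2 * D + g * z ^ 2 := by
      field_simp
    have r2 : 2 / (n:ℝ) ^ 4 * (n ^ 2 * A + (n * z) ^ 2 / 2) * (n ^ 2 * B + (n * z) ^ 2 / 2)
        = 2 * (A + z ^ 2 / 2) * (B + z ^ 2 / 2) := by field_simp
    rw [r1, r2]
    have : 2 * A * B ≤ 2 * (A + z ^ 2 / 2) * (B + z ^ 2 / 2) := by
      have : 0 ≤ z ^ 2 := sq_nonneg z
      gcongr <;> linarith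
    linarith
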